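/- arXiv:1610.09901 — 6 statements merged into one kernel-verified Lean document; each statement's English description precedes it below -/
import Mathlib

section
/- Let R be any set of words over X and G = ⟨X | R⟩ the presented group. If x₁x₂⋯xₙ is a chain word with witnessing letters v₁,…,v_{n−1} and b₁,…,b_{n−2} (so v₁ = x₁, v_{n−1} = xₙ⁻¹, and vᵢ xᵢ₊₁ vᵢ₊₁⁻¹ bᵢ⁻¹ ∈ R for all 1 ≤ i ≤ n−2), then the words x₁x₂⋯xₙ and b₁b₂⋯b_{n−2} represent the same element of G. In particular, a chain word has a strictly shorter representative of the same group element and hence is not geodesic. -/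
namespace KnotSC

variable {X : Type*}

/-- A letter: a generator together with a sign (`true` = the generator itself,
`false` = its formal inverse). -/
abbrev Letter (X : Type*) := X × Bool

/-- A word is a finite list of letters. -/
abbrev Word (X : Type*) := List (Letter X)

/-- The formal inverse of a letter. -/
def Letter.inv (a : Letter X) : Letter X := (a.1, !a.2)

/-- The formal inverse of a word. -/
def Word.inv (w : Word X) : Word X := (w.map Letter.inv).reverse

/-- A word is freely reduced if it has no two adjacent letters of the form `y`, `y⁻¹`. -/
def Reduced (w : Word X) : Prop := w.Chain' fun a b => b ≠ Letter.inv a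

/-- A word is cyclically reduced if it is freely reduced and its first letter is not the
inverse of its last letter. -/
def CyclicallyReduced (w : Word X) : Prop :=
  Reduced w ∧ ∀ a ∈ w.getLast?, ∀ b ∈ w.head?, b ≠ Letter.inv a

/-- A set of relators is symmetrized if every word in it is cyclically reduced and it is
closed under cyclic permutations and under inversion of words. -/
structure Symmetrized (R : Set (Word X)) : Prop where
  cyclicallyReduced : ∀ w ∈ R, CyclicallyReduced w
  cyclicPerm_mem : ∀ u v : Word X, u ++ v ∈ R → v ++ u ∈ R
  inv_mem : ∀ w ∈ R, Word.inv w ∈ R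

/-- A nonempty word `p` is a piece if it is a common prefix of two distinct relators. -/
def IsPiece (R : Set (Word X)) (p : Word X) : Prop :=
  p ≠ [] ∧ ∃ s ∈ R, ∃ t ∈ R, s ≠ t ∧ p <+: s ∧ p <+: t

/-- The small cancellation condition `C''(4)`: every relator has length four and no relator
is a concatenation of fewer than four pieces. -/
def CondC4 (R : Set (Word X)) : Prop :=
  ∀ r ∈ R, r.length = 4 ∧
    ¬ ∃ ps : List (Word X), ps.length < 4 ∧ (∀ p ∈ ps, IsPiece R p) ∧ ps.flatten = r

/-- `NoCancel u v` says that the concatenation `u ++ v` is freely reduced at the junction. -/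
def NoCancel (u v : Word X) : Prop :=
  ∀ a ∈ u.getLast?, ∀ b ∈ v.head?, b ≠ Letter.inv a

/-- The small cancellation condition `T(4)`. -/
def CondT4 (R : Set (Word X)) : Prop :=
  ∀ r₁ ∈ R, ∀ r₂ ∈ R, ∀ r₃ ∈ R,
    r₂ ≠ Word.inv r₁ → r₃ ≠ Word.inv r₂ → r₁ ≠ Word.inv r₃ →
    NoCancel r₁ r₂ ∨ NoCancel r₂ r₃ ∨ NoCancel r₃ r₁

/-- A square presentation: a symmetrized presentation satisfying `C''(4)` and `T(4)`. -/
structure SquarePresentation (R : Set (Word X)) : Prop where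
  symm : Symmetrized R
  c4 : CondC4 R
  t4 : CondT4 R

/-- The group presented by `⟨X | R⟩`: the quotient of the free group on `X` by the normal
closure of the elements represented by the relators. -/
abbrev PresGroup (R : Set (Word X)) : Type _ :=
  FreeGroup X ⧸ Subgroup.normalClosure (FreeGroup.mk '' R)

/-- The element of the presented group represented by a word. -/
def wordElem (R : Set (Word X)) (w : Word X) : PresGroup R :=
  QuotientGroup.mk (FreeGroup.mk w)

/-- A word is geodesic if its length is minimal among all words representing the same
element of the presented group. -/
def Geodesic (R : Set (Word X)) (w : Word X) : Prop :=
  ∀ w' : Word X, wordElem R w' = wordElem R w → w.length ≤ w'.length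

/-- A chain word: a word `x₁ ⋯ xₙ` (`n ≥ 3`, zero-indexed here as `x 0, …, x (n-1)`) such
that there are letters `v₁, …, v_{n-1}` (here `v 0, …, v (n-2)`) and `b₁, …, b_{n-2}` (here
`b 0, …, b (n-3)`) with `v₁ = x₁`, `v_{n-1} = xₙ⁻¹` and `vᵢ xᵢ₊₁ vᵢ₊₁⁻¹ bᵢ⁻¹ ∈ R` for
`1 ≤ i ≤ n-2`. -/
def IsChainWord (R : Set (Word X)) (w : Word X) : Prop :=
  ∃ (n : ℕ) (x v b : ℕ → Letter X),
    3 ≤ n ∧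
    w = (List.range n).map x ∧
    v 0 = x 0 ∧
    v (n - 2) = Letter.inv (x (n - 1)) ∧
    ∀ i < n - 2, [v i, x (i + 1), Letter.inv (v (i + 1)), Letter.inv (b i)] ∈ R

theorem wordElem_append (R : Set (Word X)) (u w : Word X) :
    wordElem R (u ++ w) = wordElem R u * wordElem R w := by
  unfold wordElem
  rw [← FreeGroup.mul_mk, QuotientGroup.mk_mul]

theorem wordElem_inv (R : Set (Word X)) (a : Letter X) :
    wordElem R [Letter.inv a] = (wordElem R [a])⁻¹ := by
  unfold wordElem
  rw [← QuotientGroup.mk_inv, FreeGroup.inv_mk]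
  simp [FreeGroup.invRev, Letter.inv]

theorem wordElem_rel (R : Set (Word X)) (w : Word X) (h : w ∈ R) : wordElem R w = 1 := by
  unfold wordElem
  rw [QuotientGroup.eq_one_iff]
  exact Subgroup.subset_normalClosure ⟨w, h, rfl⟩

theorem wordElem_square (R : Set (Word X)) (p q r s : Letter X)
    (h : [p, q, Letter.inv r, Letter.inv s] ∈ R) :
    wordElem R [p] * wordElem R [q] = wordElem R [s] * wordElem R [r] := by
  have h1 := wordElem_rel R _ h
  have h2 : [p, q, Letter.inv r, Letter.inv s]
      = (([p] ++ [q]) ++ [Letter.inv r]) ++ [Letter.inv s] := rfl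
  rw [h2, wordElem_append, wordElem_append, wordElem_append, wordElem_inv, wordElem_inv,
    mul_inv_eq_one, mul_inv_eq_iff_eq_mul] at h1
  exact h1

theorem chain_prefix (R : Set (Word X)) (m : ℕ) (x v b : ℕ → Letter X)
    (hv0 : v 0 = x 0)
    (hrel : ∀ i < m, [v i, x (i + 1), Letter.inv (v (i + 1)), Letter.inv (b i)] ∈ R) :
    ∀ k ≤ m, wordElem R ((List.range (k + 1)).map x)
      = wordElem R ((List.range k).map b) * wordElem R [v k] := by
  intro k
  induction k with
  | zero =>
    intro _
    rw [← wordElem_append]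
    simp [hv0]
  | succ k ih =>
    intro hk
    have hs := wordElem_square R _ _ _ _ (hrel k (by omega))
    rw [List.range_succ, List.map_append, wordElem_append, ih (by omega),
      List.range_succ (n := k), List.map_append, wordElem_append, mul_assoc, mul_assoc]
    exact congrArg _ hs

/-- A chain word represents the same element of the presented group as its complementary
word `b₁ ⋯ b_{n-2}`, which is strictly shorter; hence a chain word is not geodesic. -/
theorem chainWord_not_geodesic (R : Set (Word X)) (n : ℕ) (x v b : ℕ → Letter X)
    (hn : 3 ≤ n)
    (hv0 : v 0 = x 0)
    (hvlast : v (n - 2) = Letter.inv (x (n - 1)))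
    (hrel : ∀ i < n - 2,
      [v i, x (i + 1), Letter.inv (v (i + 1)), Letter.inv (b i)] ∈ R) :
    wordElem R ((List.range n).map x) = wordElem R ((List.range (n - 2)).map b) ∧
    ((List.range (n - 2)).map b).length < ((List.range n).map x).length ∧
    ¬ Geodesic R ((List.range n).map x) := by
  have key : wordElem R ((List.range n).map x) = wordElem R ((List.range (n - 2)).map b) := by
    have h := chain_prefix R (n - 2) x v b hv0 hrel (n - 2) le_rfl
    obtain ⟨m, rfl⟩ : ∃ m, n = m + 2 := ⟨n - 2, by omega⟩
    simp only [Nat.add_sub_cancel, show m + 2 - 1 = m + 1 from rfl] at h hvlast ⊢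
    rw [List.range_succ, List.map_append, wordElem_append, h, hvlast, wordElem_inv]
    simp
  have hlen : ((List.range (n - 2)).map b).length < ((List.range n).map x).length := by
    simp only [List.length_map, List.length_range]
    omega
  exact ⟨key, hlen, fun hg => absurd (hg _ key.symm) (not_le.mpr hlen)⟩

end KnotSC
end

section
/- Let R be a symmetrized set of words over X satisfying C''(4), and suppose in addition that every single letter occurring in some word of R is a piece. Then a two-letter subword uniquely determines a relator: if r and s belong to R and r and s have the same two-letter prefix, then r = s. -/
namespace KnotSC

variable {X : Type*}

/-- If `R` is symmetrized, satisfies `C''(4)`, and every single letter occurring in some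
relator is a piece, then a two-letter prefix uniquely determines a relator. -/
theorem pair_determines_relator (R : Set (Word X)) (hsymm : Symmetrized R)
    (hc4 : CondC4 R)
    (hletter : ∀ r ∈ R, ∀ a ∈ r, IsPiece R [a]) :
    ∀ r ∈ R, ∀ s ∈ R, ∀ p : Word X, p.length = 2 → p <+: r → p <+: s → r = s := by
  intro r hr s hs p hp hpr hps
  by_contra hne
  obtain ⟨t, rfl⟩ := hpr
  obtain ⟨hlen, hno⟩ := hc4 _ hr
  have ht : t.length = 2 := by
    rw [List.length_append] at hlen
    omega
  obtain ⟨c, d, rfl⟩ := List.length_eq_two.mp ht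
  refine hno ⟨[p, [c], [d]], by simp, ?_, by simp⟩
  intro q hq
  simp only [List.mem_cons, List.not_mem_nil, or_false] at hq
  rcases hq with rfl | rfl | rfl
  · refine ⟨?_, _, hr, s, hs, hne, List.prefix_append _ _, hps⟩
    rintro rfl
    simp at hp
  · exact hletter _ hr c (by simp)
  · exact hletter _ hr d (by simp)


end KnotSC
end

section
/- Let ⟨X | R⟩ be a square presentation. Then no sister-set is a pair: if a, b, c are letters with b ≠ c such that the two-letter words ab and b⁻¹c are both pairs, then the two-letter word ac is not a pair. -/
namespace KnotSC

variable {X : Type*}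

/-- A pair: a two-letter word occurring as a contiguous subword of some relator. -/
def IsPair (R : Set (Word X)) (a b : Letter X) : Prop :=
  ∃ r ∈ R, [a, b] <:+: r

theorem inv_inv_letter (a : Letter X) : Letter.inv (Letter.inv a) = a := by
  simp [Letter.inv]

theorem pair_rot {R : Set (Word X)} (hR : Symmetrized R) {a b : Letter X}
    (h : IsPair R a b) : (∃ w : Word X, b :: (w ++ [a]) ∈ R) ∧ b ≠ Letter.inv a := by
  obtain ⟨r, hr, s, t, rfl⟩ := h
  have h1 : b :: ((t ++ s) ++ [a]) ∈ R := by
    have := hR.cyclicPerm_mem (s ++ [a]) ([b] ++ t) (by simpa using hr)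
    simpa using this
  refine ⟨⟨_, h1⟩, ?_⟩
  refine (hR.cyclicallyReduced _ h1).2 a ?_ b ?_
  · rw [← List.cons_append, List.getLast?_append]; simp
  · simp

theorem inv_form (a b : Letter X) (w : Word X) :
    Word.inv (b :: (w ++ [a])) = Letter.inv a :: (Word.inv w ++ [Letter.inv b]) := by
  simp [Word.inv]

theorem last_eq {a b c d : Letter X} {u v : Word X}
    (h : a :: (u ++ [b]) = c :: (v ++ [d])) : b = d := by
  have := (List.cons.inj h).2
  simpa using (List.append_inj' this rfl).2

theorem cancel {a b c : Letter X} {u v : Word X} :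
    ¬ NoCancel (b :: (u ++ [a])) (Letter.inv a :: (v ++ [c])) := by
  intro h
  refine h a ?_ (Letter.inv a) ?_ rfl
  · rw [← List.cons_append, List.getLast?_append]; simp
  · simp

/-- In a square presentation, no sister-set is a pair: if `ab` and `b⁻¹c` are pairs with
`b ≠ c`, then `ac` is not a pair. -/
theorem sisterSet_not_pair (R : Set (Word X)) (hR : SquarePresentation R)
    (a b c : Letter X) (hbc : b ≠ c)
    (hab : IsPair R a b) (hb'c : IsPair R (Letter.inv b) c) :
    ¬ IsPair R a c := by
  intro hac
  obtain ⟨⟨u, hu⟩, hab'⟩ := pair_rot hR.symm hab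
  obtain ⟨⟨v, hv⟩, -⟩ := pair_rot hR.symm hb'c
  obtain ⟨⟨w, hw⟩, hac'⟩ := pair_rot hR.symm hac
  have hw' := hR.symm.inv_mem _ hw
  rw [inv_form] at hw'
  have key := hR.t4 _ hu _ hw' _ hv
  suffices hs : _ ∧ _ ∧ _ by
    have := key hs.1 hs.2.1 hs.2.2
    rcases this with h | h | h
    · exact cancel h
    · have hc := inv_inv_letter c
      exact cancel (a := Letter.inv c) (by rw [hc]; exact h)
    · exact cancel (a := Letter.inv b) (by rw [inv_inv_letter b]; exact h)
  refine ⟨?_, ?_, ?_⟩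
  · intro h
    rw [inv_form] at h
    have := congrArg Letter.inv (last_eq h)
    rw [inv_inv_letter, inv_inv_letter] at this
    exact hbc this.symm
  · intro h
    rw [inv_form] at h
    have := congrArg Letter.inv (last_eq h)
    rw [inv_inv_letter, inv_inv_letter] at this
    exact hab' this
  · intro h
    rw [inv_form] at h
    have := congrArg Letter.inv (last_eq h)
    rw [inv_inv_letter] at this
    exact hac' this.symm

end KnotSC
end

section
/- Let S be a type, s₀ ∈ S a distinguished generator, and R a set of words over S every element of which is sign-alternating of even length. Let A = ⟨S | R⟩ and D = ⟨S | R ∪ {s₀}⟩ be the corresponding presented groups. Then A is isomorphic to the free product D ∗ ℤ. Moreover, an isomorphism A → D ∗ ℤ is given by sending the class of each generator s ∈ S to d_s · t⁻¹, where d_s denotes the image of s in the factor D and t denotes a generator of the factor ℤ (note d_{s₀} = 1, so s₀ is sent to t⁻¹). -/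
namespace KnotSC

variable {X : Type*}

/-- A word is sign-alternating of even length if it has the form
`g₁ g₂⁻¹ g₃ g₄⁻¹ ⋯ g_{2k-1} g_{2k}⁻¹`. -/
def SignAltEven (w : Word X) : Prop :=
  ∃ (k : ℕ) (g : ℕ → X), w = (List.range (2 * k)).map fun i => ((g i, i % 2 == 0) : Letter X)

theorem lift_signAlt {S G : Type*} [Group G] (f h : S → G) (c : G)
    (hf : ∀ s, f s = h s * c) (r : Word S) (hr : SignAltEven r) :
    FreeGroup.lift f (FreeGroup.mk r) = FreeGroup.lift h (FreeGroup.mk r) := by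
  obtain ⟨k, g, rfl⟩ := hr
  simp only [FreeGroup.lift_mk]
  induction k with
  | zero => simp
  | succ k ih =>
    have e : 2 * (k + 1) = 2 * k + 1 + 1 := by ring
    have h1 : (2 * k + 1) % 2 = 1 := by omega
    rw [e, List.range_succ, List.range_succ]
    simp only [List.map_append, List.prod_append, ih]
    simp [hf, h1, mul_assoc]

theorem presLift_aux {S G : Type*} [Group G] (R : Set (Word S)) (f : S → G)
    (hf : ∀ r ∈ R, FreeGroup.lift f (FreeGroup.mk r) = 1) :
    ∃ F : PresGroup R →* G, ∀ s, F (wordElem R [(s, true)]) = f s := by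
  have hle : Subgroup.normalClosure (FreeGroup.mk '' R) ≤ (FreeGroup.lift f).ker := by
    apply Subgroup.normalClosure_le_normal
    rintro _ ⟨r, hr, rfl⟩
    exact hf r hr
  refine ⟨QuotientGroup.lift _ (FreeGroup.lift f) hle, fun s => ?_⟩
  change FreeGroup.lift f (FreeGroup.mk [(s, true)]) = f s
  simp

theorem pres_hom_ext {S G : Type*} [Group G] (R : Set (Word S)) (F F' : PresGroup R →* G)
    (h : ∀ s, F (wordElem R [(s, true)]) = F' (wordElem R [(s, true)])) : F = F' := by
  apply QuotientGroup.monoidHom_ext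
  apply FreeGroup.ext_hom
  intro s
  exact h s

theorem lift_wordElem {S G : Type*} [Group G] (R : Set (Word S)) (F : PresGroup R →* G)
    (r : Word S) (hr : r ∈ R) :
    FreeGroup.lift (fun s => F (wordElem R [(s, true)])) (FreeGroup.mk r) = 1 := by
  have e : FreeGroup.lift (fun s => F (wordElem R [(s, true)])) =
      F.comp (QuotientGroup.mk' (Subgroup.normalClosure (FreeGroup.mk '' R))) := by
    apply FreeGroup.ext_hom
    intro s
    rw [FreeGroup.lift_apply_of]
    rfl
  rw [e, MonoidHom.comp_apply]
  have : QuotientGroup.mk' (Subgroup.normalClosure (FreeGroup.mk '' R)) (FreeGroup.mk r) = 1 :=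
    (QuotientGroup.eq_one_iff _).2 (Subgroup.subset_normalClosure ⟨r, hr, rfl⟩)
  rw [this, map_one]

/-- If every relator in `R` is sign-alternating of even length, then the group
`⟨S | R⟩` is isomorphic to the free product `⟨S | R ∪ {s₀}⟩ ∗ ℤ`, via an isomorphism
sending the class of each generator `s` to `d_s · t⁻¹`, where `d_s` is the image of `s`
in the factor `⟨S | R ∪ {s₀}⟩` and `t` is a generator of the factor `ℤ`. -/
theorem augmented_group_free_product {S : Type*} (s₀ : S) (R : Set (Word S))
    (hR : ∀ r ∈ R, SignAltEven r) :
    ∃ φ : PresGroup R ≃*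
        Monoid.Coprod (PresGroup (insert [((s₀ : S), true)] R)) (Multiplicative ℤ),
      ∀ s : S,
        φ (wordElem R [(s, true)]) =
          Monoid.Coprod.inl (wordElem (insert [((s₀ : S), true)] R) [(s, true)]) *
            (Monoid.Coprod.inr (M := PresGroup (insert [((s₀ : S), true)] R))
              (Multiplicative.ofAdd (1 : ℤ)))⁻¹ := by
  set R' : Set (Word S) := insert [((s₀ : S), true)] R with hR'
  let t : Monoid.Coprod (PresGroup R') (Multiplicative ℤ) :=
    Monoid.Coprod.inr (Multiplicative.ofAdd (1 : ℤ))
  let a : S → PresGroup R := fun s => wordElem R [(s, true)]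
  let d : S → PresGroup R' := fun s => wordElem R' [(s, true)]
  have hd0 : d s₀ = 1 :=
    (QuotientGroup.eq_one_iff _).2
      (Subgroup.subset_normalClosure ⟨_, Set.mem_insert _ _, rfl⟩)
  obtain ⟨F, hF⟩ := presLift_aux R (fun s =>
      (Monoid.Coprod.inl (d s) : Monoid.Coprod (PresGroup R') (Multiplicative ℤ)) * t⁻¹) (by
    intro r hr
    rw [lift_signAlt _ (fun s => Monoid.Coprod.inl (d s)) t⁻¹ (fun _ => rfl) r (hR r hr)]
    exact lift_wordElem (G := Monoid.Coprod (PresGroup R') (Multiplicative ℤ)) R'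
      Monoid.Coprod.inl r (Set.mem_insert_of_mem _ hr))
  obtain ⟨B, hB⟩ := presLift_aux R' (fun s => a s * (a s₀)⁻¹) (by
    intro r hr
    rcases hr with rfl | hr
    · simp
    · rw [lift_signAlt _ a (a s₀)⁻¹ (fun _ => rfl) r (hR r hr)]
      exact lift_wordElem R (MonoidHom.id _) r hr)
  let Z : Multiplicative ℤ →* PresGroup R := zpowersHom _ (a s₀)⁻¹
  have hZ : Z (Multiplicative.ofAdd 1) = (a s₀)⁻¹ := by simp [Z]
  let G := Monoid.Coprod.lift B Z
  have hF' : ∀ s, F (a s) = Monoid.Coprod.inl (d s) * t⁻¹ := hF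
  have hB' : ∀ s, B (d s) = a s * (a s₀)⁻¹ := hB
  have h1 : G.comp F = MonoidHom.id _ := by
    apply pres_hom_ext
    intro s
    change G (F (a s)) = a s
    rw [hF', map_mul, map_inv]
    simp only [G, t, Monoid.Coprod.lift_apply_inl, Monoid.Coprod.lift_apply_inr, hB', hZ]
    simp
  have h2 : F.comp G = MonoidHom.id _ := by
    apply Monoid.Coprod.hom_ext
    · apply pres_hom_ext
      intro s
      change F (G (Monoid.Coprod.inl (d s))) = Monoid.Coprod.inl (d s)
      simp only [G, Monoid.Coprod.lift_apply_inl, hB', map_mul, map_inv, hF', hd0, map_one]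
      simp
    · apply MonoidHom.ext_mint
      change F (G t) = t
      simp only [G, t, Monoid.Coprod.lift_apply_inr, hZ, map_inv, hF', hd0, map_one]
      simp
  exact ⟨MonoidHom.toMulEquiv F G h1 h2, hF⟩

end KnotSC
end

section
/- Let S be a type, s₀ ∈ S a distinguished generator, and R a set of words over S every element of which is sign-alternating of even length. Then for every sign-alternating word w of even length over S, w represents the identity in the presented group ⟨S | R⟩ if and only if w represents the identity in the presented group ⟨S | R ∪ {s₀}⟩. -/
namespace KnotSC

variable {X : Type*}

/-- Twisting every generator by `s₀⁻¹` does not change the value of an alternating word. -/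
theorem lift_twist {G : Type*} [Group G] (f : X → G) (c : G) (w : Word X) (hw : SignAltEven w) :
    FreeGroup.lift (fun x => f x * c⁻¹) (FreeGroup.mk w) = FreeGroup.lift f (FreeGroup.mk w) := by
  obtain ⟨k, g, rfl⟩ := hw
  induction k with
  | zero => simp
  | succ k ih =>
    rw [FreeGroup.lift_mk, FreeGroup.lift_mk] at *
    rw [show 2 * (k + 1) = 2 * k + 1 + 1 by ring, List.range_succ, List.range_succ]
    simp only [List.map_append, List.prod_append, ih]
    have h : (2 * k + 1) % 2 = 1 := by omega
    simp [h, mul_assoc]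

/-- If every relator in `R` is sign-alternating of even length, then a sign-alternating
word of even length represents the identity in `⟨S | R⟩` if and only if it represents the
identity in `⟨S | R ∪ {s₀}⟩`. -/
theorem augmented_word_problem {S : Type*} (s₀ : S) (R : Set (Word S))
    (hR : ∀ r ∈ R, SignAltEven r)
    (w : Word S) (hw : SignAltEven w) :
    wordElem R w = 1 ↔ wordElem (insert [((s₀ : S), true)] R) w = 1 := by
  have key : ∀ v : Word S, FreeGroup.lift
      (fun x => (QuotientGroup.mk (FreeGroup.of x) : PresGroup R)) (FreeGroup.mk v)
      = wordElem R v := by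
    intro v
    have : FreeGroup.lift (fun x => (QuotientGroup.mk (FreeGroup.of x) : PresGroup R))
        = QuotientGroup.mk' (Subgroup.normalClosure (FreeGroup.mk '' R)) := by
      ext x
      simp
    rw [this]
    rfl
  constructor
  · intro h
    have h' := (QuotientGroup.eq_one_iff _).1 h
    exact (QuotientGroup.eq_one_iff _).2
      (Subgroup.normalClosure_mono (Set.image_mono (Set.subset_insert _ _)) h')
  · intro h
    have h' := (QuotientGroup.eq_one_iff _).1 h
    have hle : Subgroup.normalClosure (FreeGroup.mk '' (insert [((s₀ : S), true)] R)) ≤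
        (FreeGroup.lift (fun x => (QuotientGroup.mk (FreeGroup.of x) : PresGroup R) *
          (QuotientGroup.mk (FreeGroup.of s₀) : PresGroup R)⁻¹)).ker := by
      apply Subgroup.normalClosure_le_normal
      rintro _ ⟨r, hr, rfl⟩
      rw [SetLike.mem_coe, MonoidHom.mem_ker]
      rcases hr with rfl | hr
      · rw [FreeGroup.lift_mk]
        simp
      · rw [lift_twist _ _ _ (hR r hr), key]
        exact (QuotientGroup.eq_one_iff _).2 (Subgroup.subset_normalClosure ⟨r, hr, rfl⟩)
    have h2 := MonoidHom.mem_ker.1 (hle h')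
    rwa [lift_twist _ _ _ hw, key] at h2

end KnotSC
end

section
/- Let R be a symmetrized set of words over X, all of length four, such that any two words of R having the same two-letter prefix are equal. If two R-tilings of the plane (H, V) and (H′, V′) assign the same labels to the edges of every diagonal unit square, i.e. for all i ∈ ℤ one has H(i,i) = H′(i,i), H(i,i+1) = H′(i,i+1), V(i,i) = V′(i,i) and V(i+1,i) = V′(i+1,i), then the tilings are equal: H = H′ and V = V′. -/
namespace KnotSC

variable {X : Type*}

/-- An `R`-tiling of the plane: `H (i, j)` labels the horizontal edge from `(i, j)` to
`(i+1, j)` and `V (i, j)` labels the vertical edge from `(i, j)` to `(i, j+1)`, and the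
boundary word `V (i,j) · H (i,j+1) · V (i+1,j)⁻¹ · H (i,j)⁻¹` of every unit square
belongs to `R`. -/
def IsTiling (R : Set (Word X)) (H V : ℤ × ℤ → Letter X) : Prop :=
  ∀ i j : ℤ,
    [V (i, j), H (i, j + 1), Letter.inv (V (i + 1, j)), Letter.inv (H (i, j))] ∈ R

theorem inv_injective' : Function.Injective (Letter.inv : Letter X → Letter X) := by
  rintro ⟨a, b⟩ ⟨c, d⟩ h
  simpa [Letter.inv] using h

/-- If `R` is symmetrized, all relators have length four, and a two-letter prefix
determines a relator, then two `R`-tilings of the plane agreeing on the edges of every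
diagonal unit square are equal. -/
theorem tiling_determined_by_diagonal (R : Set (Word X)) (hsymm : Symmetrized R)
    (hlen : ∀ r ∈ R, r.length = 4)
    (hpair : ∀ r ∈ R, ∀ s ∈ R, ∀ p : Word X, p.length = 2 → p <+: r → p <+: s → r = s)
    (H V H' V' : ℤ × ℤ → Letter X)
    (hT : IsTiling R H V) (hT' : IsTiling R H' V')
    (hdiag : ∀ i : ℤ,
      H (i, i) = H' (i, i) ∧ H (i, i + 1) = H' (i, i + 1) ∧
      V (i, i) = V' (i, i) ∧ V (i + 1, i) = V' (i + 1, i)) :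
    H = H' ∧ V = V' := by
  have up : ∀ a b c d a' b' c' d' : Letter X, [a, b, c, d] ∈ R → [a', b', c', d'] ∈ R →
      a = a' → b = b' → c = c' ∧ d = d' := by
    intro a b c d a' b' c' d' h h' e1 e2
    subst e1 e2
    have := hpair _ h _ h' [a, b] rfl ⟨[c, d], rfl⟩ ⟨[c', d'], rfl⟩
    simpa using this
  have main : ∀ n : ℕ,
      (∀ i : ℤ, H (i, i + n) = H' (i, i + n) ∧ H (i, i + n + 1) = H' (i, i + n + 1) ∧
        V (i, i + n) = V' (i, i + n) ∧ V (i + 1, i + n) = V' (i + 1, i + n)) ∧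
      (∀ i : ℤ, H (i, i - n) = H' (i, i - n) ∧ H (i, i - n + 1) = H' (i, i - n + 1) ∧
        V (i, i - n) = V' (i, i - n) ∧ V (i + 1, i - n) = V' (i + 1, i - n)) := by
    intro n
    induction n with
    | zero => simpa using hdiag
    | succ n ih =>
      obtain ⟨ih1, ih2⟩ := ih
      constructor
      · intro i
        have e1 := (ih1 i).2.1
        have e2 := (ih1 (i + 1)).2.2.1
        have k1 : i + ((n + 1 : ℕ) : ℤ) = i + n + 1 := by push_cast; ring
        have k2 : i + 1 + (n : ℤ) = i + n + 1 := by ring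
        rw [k2] at e2
        rw [k1]
        have h := hsymm.cyclicPerm_mem [_, _] [_, _] (hT i (i + n + 1))
        have h' := hsymm.cyclicPerm_mem [_, _] [_, _] (hT' i (i + n + 1))
        obtain ⟨e3, e4⟩ := up _ _ _ _ _ _ _ _ h h' (by rw [e2]) (by rw [e1])
        exact ⟨e1, e4, e3, e2⟩
      · intro i
        have e1 := (ih2 i).1
        have e2 := (ih2 (i - 1)).2.2.2
        have k1 : i - ((n + 1 : ℕ) : ℤ) = i - n - 1 := by push_cast; ring
        have k2 : i - 1 - (n : ℤ) = i - n - 1 := by ring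
        have k3 : i - (n : ℤ) - 1 + 1 = i - n := by ring
        rw [k2, sub_add_cancel] at e2
        rw [k1]
        have h := hT i (i - n - 1)
        have h' := hT' i (i - n - 1)
        rw [k3] at h h' ⊢
        obtain ⟨e3, e4⟩ := up _ _ _ _ _ _ _ _ h h' e2 e1
        exact ⟨inv_injective' e4, e1, e2, inv_injective' e3⟩
  have all : ∀ i j : ℤ, H (i, j) = H' (i, j) ∧ V (i, j) = V' (i, j) := by
    intro i j
    rcases le_total i j with h | h
    · obtain ⟨n, hn⟩ := Int.le.dest h
      subst hn
      exact ⟨((main n).1 i).1, ((main n).1 i).2.2.1⟩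
    · obtain ⟨n, hn⟩ := Int.le.dest h
      obtain rfl : j = i - n := by omega
      exact ⟨((main n).2 i).1, ((main n).2 i).2.2.1⟩
  exact ⟨funext fun p => (all p.1 p.2).1, funext fun p => (all p.1 p.2).2⟩


end KnotSC
end
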